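/- (Oscillation cancellation identity) In the setting of the preceding cancellation identity — Λ ⊆ 𝕊^{d−1} finite; γ_{(k)} with S = Σ_{k∈Λ} γ_{(k)}(S)² (k⊗k) on the ε_u-ball around Id; φ_{(k)} : 𝕋^d → ℝ with ⨍_{𝕋^d} φ_{(k)}² = 1 and W_{(k)} := φ_{(k)} k; ρ > 0, ϱ > 0, f, and symmetric R with ‖R(t,x)‖ ≤ ε_u ϱ(t) and f(t) = 1 whenever R(t,·) ≢ 0; a_{(k)} := f ϱ^{1/2} ρ^{1/2} γ_{(k)}(Id − R/ϱ) — assume additionally that g_{(k)} : [0,T] → ℝ, k ∈ Λ, have pairwise disjoint supports. Define the principal perturbation w^{(p)}(t,x) := Σ_{k∈Λ} a_{(k)}(t,x) g_{(k)}(t) W_{(k)}(x). Then for all (t,x): ρ^{−1} w^{(p)} ⊗ w^{(p)} + R = ϱ f² Id + Σ_{k∈Λ} ρ^{−1} a_{(k)}² g_{(k)}² ℙ_{≠0}( W_{(k)} ⊗ W_{(k)} ) + Σ_{k∈Λ} ρ^{−1} a_{(k)}² ( g_{(k)}² − 1 ) (k ⊗ k), where ℙ_{≠0} F := F − ⨍_{𝕋^d}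 F dy denotes subtraction of the spatial mean. -/

import Mathlib

open Real MeasureTheory

noncomputable section

/-- The Frobenius norm of a `d × d` real matrix (represented as `Fin d → Fin d → ℝ`). -/
def frobNorm {d : ℕ} (S : Fin d → Fin d → ℝ) : ℝ :=
  Real.sqrt (∑ i, ∑ j, (S i j) ^ 2)

/-- The identity matrix. -/
def idMat (d : ℕ) : Fin d → Fin d → ℝ := fun i j => if i = j then 1 else 0

/-- A function on `ℝ^d` that is `2π`-periodic in every coordinate. -/
def SpacePeriodic {d : ℕ} {E : Type*} (u : (Fin d → ℝ) → E) : Prop :=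
  ∀ (x : Fin d → ℝ) (n : Fin d → ℤ), u (fun i => x i + 2 * π * n i) = u x

/-- The fundamental domain `[-π,π]^d ⊆ ℝ^d` of the torus `𝕋^d`. -/
def fundDomain (d : ℕ) : Set (Fin d → ℝ) := Set.univ.pi fun _ => Set.Icc (-π) π

/-- A product of two finite sums whose off-diagonal products vanish is the sum of the
diagonal products. -/
theorem sum_mul_sum_eq_sum_mul_of_offDiag_eq_zero {ι A : Type*} [NonUnitalNonAssocSemiring A]
    (s : Finset ι) (u v : ι → A)
    (h : ∀ k ∈ s, ∀ k' ∈ s, k ≠ k' → u k * v k' = 0) :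
    (∑ k ∈ s, u k) * (∑ k ∈ s, v k) = ∑ k ∈ s, u k * v k := by
  rw [Finset.sum_mul_sum]
  exact Finset.sum_congr rfl fun k hk =>
    Finset.sum_eq_single k (fun k' hk' hne => h k hk k' hk' hne.symm) (fun hn => absurd hk hn)

theorem frobNorm_neg_div {d : ℕ} (S : Fin d → Fin d → ℝ) {c : ℝ} (hc : 0 < c) :
    frobNorm (fun i j => -(S i j / c)) = frobNorm S / c := by
  have h : ∑ i, ∑ j, (-(S i j / c)) ^ 2 = (∑ i, ∑ j, (S i j) ^ 2) / c ^ 2 := by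
    simp only [neg_sq, div_pow, Finset.sum_div]
  rw [frobNorm, frobNorm, h, Real.sqrt_div' _ (sq_nonneg c), Real.sqrt_sq hc.le]

/-- **Oscillation cancellation identity.** For the principal perturbation
`w^{(p)} = ∑_{k ∈ Λ} a_{(k)} g_{(k)} W_{(k)}` with amplitudes
`a_{(k)} = f ϱ^{1/2} ρ^{1/2} γ_{(k)}(Id - R/ϱ)`, normalized Mikado flows
`W_{(k)} = φ_{(k)} k`, and temporal oscillations `g_{(k)}` with pairwise disjoint supports,
`ρ⁻¹ w^{(p)} ⊗ w^{(p)} + R = ϱ f² Id`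
`+ ∑_k ρ⁻¹ a_{(k)}² g_{(k)}² ℙ_{≠0}(W_{(k)} ⊗ W_{(k)}) + ∑_k ρ⁻¹ a_{(k)}² (g_{(k)}² - 1) k ⊗ k`,
where `ℙ_{≠0} F = F - ⨍_{𝕋^d} F`. -/
theorem oscillation_cancellation
    (d : ℕ) (hd : 2 ≤ d) (T : ℝ) (hT : 0 < T) (εu : ℝ) (hεu : 0 < εu)
    (Λ : Finset (Fin d → ℝ)) (hΛ : ∀ k ∈ Λ, (∑ i, (k i) ^ 2) = 1)
    (γ : (Fin d → ℝ) → (Fin d → Fin d → ℝ) → ℝ)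
    -- the conclusion of the Geometric Lemma
    (hγ : ∀ S : Fin d → Fin d → ℝ, (∀ i j, S i j = S j i) →
      frobNorm (fun i j => S i j - idMat d i j) ≤ εu →
      ∀ i j, S i j = ∑ k ∈ Λ, (γ k S) ^ 2 * (k i * k j))
    (φ : (Fin d → ℝ) → (Fin d → ℝ) → ℝ)
    (hφcont : ∀ k ∈ Λ, Continuous (φ k))
    (hφper : ∀ k ∈ Λ, SpacePeriodic (φ k))
    -- normalization `⨍_{𝕋^d} φ_{(k)}² = 1`
    (hφnorm : ∀ k ∈ Λ, ((2 * π) ^ d)⁻¹ * ∫ y in fundDomain d, (φ k y) ^ 2 = 1)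
    (ρ : ℝ → (Fin d → ℝ) → ℝ) (hρpos : ∀ t ∈ Set.Icc (0 : ℝ) T, ∀ x, 0 < ρ t x)
    (f : ℝ → ℝ)
    (ϱ : ℝ → ℝ) (hϱpos : ∀ t ∈ Set.Icc (0 : ℝ) T, 0 < ϱ t)
    (R : ℝ → (Fin d → ℝ) → Fin d → Fin d → ℝ)
    (hRsymm : ∀ t ∈ Set.Icc (0 : ℝ) T, ∀ x i j, R t x i j = R t x j i)
    (hRϱ : ∀ t ∈ Set.Icc (0 : ℝ) T, ∀ x, frobNorm (R t x) ≤ εu * ϱ t)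
    -- `f(t) = 1` whenever `R(t,·)` is not identically zero
    (hf1 : ∀ t ∈ Set.Icc (0 : ℝ) T, (∃ x i j, R t x i j ≠ 0) → f t = 1)
    -- temporal oscillations with pairwise disjoint supports
    (g : (Fin d → ℝ) → ℝ → ℝ)
    (hgdisj : ∀ k ∈ Λ, ∀ k' ∈ Λ, k ≠ k' → ∀ t : ℝ, g k t = 0 ∨ g k' t = 0) :
    ∀ t ∈ Set.Icc (0 : ℝ) T, ∀ (x : Fin d → ℝ) (i j : Fin d),
      -- abbreviation: `a k` is the amplitude, `w` the principal perturbation at `(t,x)`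
      (fun (a : (Fin d → ℝ) → ℝ) (w : Fin d → ℝ) =>
          (ρ t x)⁻¹ * (w i * w j) + R t x i j
            = ϱ t * (f t) ^ 2 * idMat d i j
              + (∑ k ∈ Λ, (ρ t x)⁻¹ * (a k) ^ 2 * (g k t) ^ 2 *
                  ((φ k x * k i) * (φ k x * k j)
                    - ((2 * π) ^ d)⁻¹ * ∫ y in fundDomain d, (φ k y * k i) * (φ k y * k j)))
              + ∑ k ∈ Λ, (ρ t x)⁻¹ * (a k) ^ 2 * ((g k t) ^ 2 - 1) * (k i * k j))
        (fun k => f t * Real.sqrt (ϱ t) * Real.sqrt (ρ t x) *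
          γ k fun i' j' => idMat d i' j' - R t x i' j' / ϱ t)
        (fun i' => ∑ k ∈ Λ,
          (f t * Real.sqrt (ϱ t) * Real.sqrt (ρ t x) *
              γ k fun a b => idMat d a b - R t x a b / ϱ t) * g k t * (φ k x * k i')) := by
  intro t ht x i j
  have hϱ := hϱpos t ht
  have hρ := hρpos t ht x
  have hgeom := hγ (fun i' j' => idMat d i' j' - R t x i' j' / ϱ t)
    (fun i' j' => by simp only [hRsymm t ht x i' j', idMat, eq_comm])
    (by
      simp only [sub_sub_cancel_left]
      rw [frobNorm_neg_div _ hϱ, div_le_iff₀ hϱ]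
      exact hRϱ t ht x) i j
  have hfR : f t ^ 2 * R t x i j = R t x i j := by
    by_cases hR : R t x i j = 0
    · rw [hR, mul_zero]
    · rw [hf1 t ht ⟨x, i, j, hR⟩, one_pow, one_mul]
  have hmean : ∀ k ∈ Λ, ((2 * π) ^ d)⁻¹ *
      ∫ y in fundDomain d, (φ k y * k i) * (φ k y * k j) = k i * k j := by
    intro k hk
    have h : ∀ y, (φ k y * k i) * (φ k y * k j) = φ k y ^ 2 * (k i * k j) := fun y => by ring
    simp only [h]
    rw [integral_mul_const, ← mul_assoc, hφnorm k hk, one_mul]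
  beta_reduce
  set G : (Fin d → ℝ) → ℝ := fun k => γ k fun i' j' => idMat d i' j' - R t x i' j' / ϱ t with hG
  rw [sum_mul_sum_eq_sum_mul_of_offDiag_eq_zero Λ _ _ fun k hk k' hk' hne => by
    rcases hgdisj k hk k' hk' hne t with h | h <;> simp [h]]
  have hsplit : f t ^ 2 * ϱ t * (idMat d i j - R t x i j / ϱ t)
      = ∑ k ∈ Λ, f t ^ 2 * ϱ t * (G k ^ 2 * (k i * k j)) := by
    rw [hgeom, Finset.mul_sum]
  have hR : R t x i j = ϱ t * f t ^ 2 * idMat d i j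
      - ∑ k ∈ Λ, f t ^ 2 * ϱ t * (G k ^ 2 * (k i * k j)) := by
    rw [← hsplit, mul_sub, mul_assoc _ _ (R t x i j / ϱ t), mul_div_cancel₀ _ hϱ.ne', hfR]
    ring
  have ha : ∀ k, (ρ t x)⁻¹ * (f t * √(ϱ t) * √(ρ t x) * G k) ^ 2 = f t ^ 2 * ϱ t * G k ^ 2 := by
    intro k
    rw [mul_pow, mul_pow, mul_pow, Real.sq_sqrt hϱ.le, Real.sq_sqrt hρ.le]
    field_simp
  rw [hR, add_sub_left_comm, add_assoc, Finset.mul_sum, ← Finset.sum_sub_distrib,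
    ← Finset.sum_add_distrib]
  congr 1
  refine Finset.sum_congr rfl fun k hk => ?_
  rw [hmean k hk]
  linear_combination (k i * k j) * ha k

end
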